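/- arXiv:math/0404352 — 2 statements merged into one kernel-verified Lean document; each statement's English description precedes it below -/
import Mathlib

section
/- Let (W,S) be a finite Coxeter system and J ⊆ S. Then X_J = {w ∈ W : w ≤_B ξ_J}, i.e. the Solomon subset X_J consists exactly of the elements of W that are smaller than or equal to ξ_J in the weak Bruhat order. -/
/-!
Statement 0: For a finite Coxeter system `(W,S)` and `J ⊆ S`, the Solomon subset
`X_J = {w ∈ W : ℓ(w s) > ℓ(w) for all s ∈ J}` equals the set of elements of `W` that are
`≤` the element `ξ_J` in the (left) weak Bruhat order, where `ω_S = ξ_J ∘ ω_J`, `ω_S` is the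
longest element of `W` and `ω_J` is the longest element of the standard parabolic subgroup `W_J`.
-/

namespace PaperWeakBruhat

variable {B W : Type*} [Group W] {M : CoxeterMatrix B}

/-- The weak Bruhat order on `W`: `x ≤_B x'` iff `x' = y * x` with `ℓ(x') = ℓ(y) + ℓ(x)`. -/
noncomputable def weakLE (cs : CoxeterSystem M W) (x x' : W) : Prop :=
  ∃ y : W, x' = y * x ∧ cs.length x' = cs.length y + cs.length x

/-- The standard parabolic subgroup `W_J` generated by the simple reflections in `J`. -/
def parabolic (cs : CoxeterSystem M W) (J : Set B) : Subgroup W :=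
  Subgroup.closure (cs.simple '' J)

/-- The Solomon subset `X_J` of elements having no descent at `J`. -/
noncomputable def solomon (cs : CoxeterSystem M W) (J : Set B) : Set W :=
  {w : W | ∀ s ∈ J, cs.length w < cs.length (w * cs.simple s)}

/-- The action of the simple reflection `i` on `W × ZMod 2`: it conjugates the first component by
`i` and flips the second one exactly when the first component equals `i`. -/
noncomputable def reflStep (cs : CoxeterSystem M W) (i : B) : Function.End (W × ZMod 2) :=
  open Classical in
  fun p ↦ (cs.simple i * p.1 * cs.simple i, p.2 + if p.1 = cs.simple i then 1 else 0)

open Classical in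
theorem reflStep_apply (cs : CoxeterSystem M W) (i : B) (t : W) (z : ZMod 2) :
    reflStep cs i (t, z) =
      (cs.simple i * t * cs.simple i, z + if t = cs.simple i then 1 else 0) := by
  rfl

open Classical in
theorem reflStep_mul_pow_apply (cs : CoxeterSystem M W) (i j : B) (k : ℕ) (t : W) (z : ZMod 2) :
    ((reflStep cs i * reflStep cs j) ^ k) (t, z) =
      ((cs.simple i * cs.simple j) ^ k * t * ((cs.simple i * cs.simple j) ^ k)⁻¹,
        z + ∑ n ∈ Finset.range (2 * k),
          if t = cs.simple j * (cs.simple i * cs.simple j) ^ n then 1 else 0) := by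
  induction k with
  | zero => simp [Function.End.one_def]
  | succ k ih =>
    set x := cs.simple i * cs.simple j with hx
    have hinv : x⁻¹ = cs.simple j * cs.simple i := by simp [hx]
    have hjx : cs.simple j * x = x⁻¹ * cs.simple j := by
      rw [hinv, hx, mul_assoc]
    have hconj : ∀ n : ℕ, cs.simple j * x ^ n = (x ^ n)⁻¹ * cs.simple j := by
      intro n
      induction n with
      | zero => simp
      | succ n ihn =>
        rw [pow_succ, ← mul_assoc, ihn, ← pow_succ, pow_succ', mul_inv_rev, mul_assoc, hjx,
          ← mul_assoc]
    have h1 : x ^ k * t * (x ^ k)⁻¹ = cs.simple j ↔ t = cs.simple j * x ^ (2 * k) := by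
      rw [two_mul, pow_add, ← mul_assoc, hconj k, mul_inv_eq_iff_eq_mul, mul_assoc,
        eq_inv_mul_iff_mul_eq]
    have h2 : cs.simple j * (x ^ k * t * (x ^ k)⁻¹) * cs.simple j = cs.simple i ↔
        t = cs.simple j * x ^ (2 * k + 1) := by
      have e1 : ∀ y : W, cs.simple j * y * cs.simple j = cs.simple i ↔ y = cs.simple j * x := by
        intro y
        constructor
        · intro h
          rw [hx, ← h]
          simp [mul_assoc]
        · intro h
          rw [h, hx]
          simp [mul_assoc]
      have e2 : (x ^ k)⁻¹ * (cs.simple j * x * x ^ k) = cs.simple j * x ^ (2 * k + 1) := by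
        rw [mul_assoc, ← mul_assoc, ← hconj k, mul_assoc, ← pow_succ', ← pow_add, two_mul,
          add_assoc]
      rw [e1, mul_inv_eq_iff_eq_mul, ← eq_inv_mul_iff_mul_eq, e2]
    rw [pow_succ']
    change reflStep cs i (reflStep cs j (((reflStep cs i * reflStep cs j) ^ k) (t, z))) = _
    rw [ih, reflStep_apply, reflStep_apply, h1, h2, show 2 * (k + 1) = 2 * k + 1 + 1 by ring,
      Finset.sum_range_succ, Finset.sum_range_succ, pow_succ' x k, mul_inv_rev, hinv]
    simp [hx, mul_assoc, add_assoc]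

theorem isLiftable_reflStep (cs : CoxeterSystem M W) : M.IsLiftable (reflStep cs) := by
  classical
  intro i j
  funext ⟨t, z⟩
  rw [reflStep_mul_pow_apply, two_mul, Finset.sum_range_add]
  simp [pow_add, CharTwo.add_self_eq_zero, Function.End.one_def]

/-- The parity of the number of occurrences of `t` in the right inversion sequence of any word
representing `w`. -/
noncomputable def invParity (cs : CoxeterSystem M W) (w t : W) : ZMod 2 :=
  (cs.lift ⟨reflStep cs, isLiftable_reflStep cs⟩ w (t, 0)).2

open Classical in
theorem lift_reflStep_wordProd (cs : CoxeterSystem M W) (ω : List B) (t : W) (z : ZMod 2) :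
    cs.lift ⟨reflStep cs, isLiftable_reflStep cs⟩ (cs.wordProd ω) (t, z) =
      (cs.wordProd ω * t * (cs.wordProd ω)⁻¹, z + ((cs.rightInvSeq ω).count t : ZMod 2)) := by
  induction ω with
  | nil => simp [Function.End.one_def]
  | cons i ω ih =>
    rw [cs.wordProd_cons, map_mul, cs.lift_apply_simple]
    change reflStep cs i
      (cs.lift ⟨reflStep cs, isLiftable_reflStep cs⟩ (cs.wordProd ω) (t, z)) = _
    have h : cs.wordProd ω * t * (cs.wordProd ω)⁻¹ = cs.simple i ↔
        (cs.wordProd ω)⁻¹ * cs.simple i * cs.wordProd ω = t := by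
      constructor
      · intro h
        rw [← h]
        group
      · intro h
        rw [← h]
        group
    rw [ih, reflStep_apply, h]
    simp [CoxeterSystem.rightInvSeq, List.count_cons, mul_assoc, add_assoc]

open Classical in
theorem invParity_wordProd (cs : CoxeterSystem M W) (ω : List B) (t : W) :
    invParity cs (cs.wordProd ω) t = ((cs.rightInvSeq ω).count t : ZMod 2) := by
  simp [invParity, lift_reflStep_wordProd]

theorem lift_reflStep_apply (cs : CoxeterSystem M W) (w t : W) (z : ZMod 2) :
    cs.lift ⟨reflStep cs, isLiftable_reflStep cs⟩ w (t, z) =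
      (w * t * w⁻¹, z + invParity cs w t) := by
  obtain ⟨ω, rfl⟩ := cs.wordProd_surjective w
  rw [lift_reflStep_wordProd, invParity_wordProd]

theorem invParity_mul (cs : CoxeterSystem M W) (x w t : W) :
    invParity cs (x * w) t = invParity cs w t + invParity cs x (w * t * w⁻¹) := by
  have h : cs.lift ⟨reflStep cs, isLiftable_reflStep cs⟩ (x * w) (t, 0) =
      cs.lift ⟨reflStep cs, isLiftable_reflStep cs⟩ x
        (cs.lift ⟨reflStep cs, isLiftable_reflStep cs⟩ w (t, 0)) := by
    rw [map_mul]
    rfl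
  rw [lift_reflStep_apply, lift_reflStep_apply, lift_reflStep_apply] at h
  simpa using congrArg Prod.snd h

theorem invParity_one (cs : CoxeterSystem M W) (t : W) : invParity cs 1 t = 0 := by
  simpa using invParity_wordProd cs [] t

theorem invParity_simple_self (cs : CoxeterSystem M W) (i : B) :
    invParity cs (cs.simple i) (cs.simple i) = 1 := by
  simpa using invParity_wordProd cs [i] (cs.simple i)

theorem invParity_self {cs : CoxeterSystem M W} {t : W} (ht : cs.IsReflection t) :
    invParity cs t t = 1 := by
  obtain ⟨w, i, rfl⟩ := ht
  have h := invParity_mul cs w⁻¹ w (cs.simple i)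
  rw [inv_mul_cancel, invParity_one] at h
  rw [mul_assoc w, invParity_mul cs w, invParity_mul cs (cs.simple i)]
  have e1 : w⁻¹ * (w * (cs.simple i * w⁻¹)) * w⁻¹⁻¹ = cs.simple i := by group
  have e2 : cs.simple i * w⁻¹ * (w * (cs.simple i * w⁻¹)) * (cs.simple i * w⁻¹)⁻¹ =
      cs.simple i := by group
  rw [e1, e2, invParity_simple_self, ← mul_assoc w]
  linear_combination -h

theorem isRightInversion_of_invParity_ne_zero {cs : CoxeterSystem M W} {w t : W}
    (h : invParity cs w t ≠ 0) : cs.IsRightInversion w t := by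
  classical
  obtain ⟨ω, hω, rfl⟩ := cs.exists_isReduced w
  refine cs.isRightInversion_of_mem_rightInvSeq hω ?_
  by_contra hmem
  exact h (by rw [invParity_wordProd, List.count_eq_zero_of_not_mem hmem, Nat.cast_zero])

theorem isRightInversion_iff_invParity_ne_zero {cs : CoxeterSystem M W} {w t : W}
    (ht : cs.IsReflection t) : cs.IsRightInversion w t ↔ invParity cs w t ≠ 0 := by
  refine ⟨fun h h0 ↦ ?_, isRightInversion_of_invParity_ne_zero⟩
  have h1 : invParity cs (w * t) t ≠ 0 := by
    rw [invParity_mul, invParity_self ht, mul_inv_cancel_right, h0]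
    decide
  have h2 := (isRightInversion_of_invParity_ne_zero h1).2
  rw [mul_assoc, ht.mul_self, mul_one] at h2
  exact absurd h.2 h2.le.not_gt

/-- The strong exchange property. -/
theorem exists_mul_eq_wordProd_eraseIdx {cs : CoxeterSystem M W} {ω : List B} {t : W}
    (h : cs.IsRightInversion (cs.wordProd ω) t) :
    ∃ j < ω.length, cs.wordProd ω * t = cs.wordProd (ω.eraseIdx j) := by
  classical
  have hmem : t ∈ cs.rightInvSeq ω := by
    by_contra hmem
    rw [isRightInversion_iff_invParity_ne_zero h.1, invParity_wordProd,
      List.count_eq_zero_of_not_mem hmem] at h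
    exact h Nat.cast_zero
  obtain ⟨j, hj, rfl⟩ := List.mem_iff_getElem.mp hmem
  refine ⟨j, by simpa using hj, ?_⟩
  rw [← List.getD_eq_getElem _ 1 hj, cs.wordProd_mul_getD_rightInvSeq]

theorem isRightDescent_iff_invParity_ne_zero {cs : CoxeterSystem M W} {w : W} {i : B} :
    cs.IsRightDescent w i ↔ invParity cs w (cs.simple i) ≠ 0 := by
  rw [← cs.isRightInversion_simple_iff_isRightDescent,
    isRightInversion_iff_invParity_ne_zero (cs.isReflection_simple i)]

theorem length_eq_add_of_forall_length_le (cs : CoxeterSystem M W) {ωS : W}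
    (hS : ∀ w : W, cs.length w ≤ cs.length ωS) (w : W) :
    cs.length ωS = cs.length (ωS * w⁻¹) + cs.length w := by
  induction w using cs.simple_induction_left with
  | one => simp
  | mul_simple_left w i ih =>
    rw [mul_inv_rev, cs.inv_simple, ← mul_assoc]
    rcases cs.length_simple_mul w i with h | h
    · have ht : cs.IsReflection (w⁻¹ * cs.simple i * w) := ⟨w⁻¹, i, by simp⟩
      have hinv : cs.IsRightInversion ωS (w⁻¹ * cs.simple i * w) :=
        ⟨ht, lt_of_le_of_ne (hS _) (ht.length_mul_left_ne ωS)⟩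
      have hw : ¬ cs.IsRightInversion w (w⁻¹ * cs.simple i * w) := by
        rintro ⟨-, h'⟩
        have e : w * (w⁻¹ * cs.simple i * w) = cs.simple i * w := by group
        rw [e] at h'
        omega
      rw [isRightInversion_iff_invParity_ne_zero ht] at hinv hw
      have hmul := invParity_mul cs (ωS * w⁻¹) w (w⁻¹ * cs.simple i * w)
      have e : w * (w⁻¹ * cs.simple i * w) * w⁻¹ = cs.simple i := by group
      rw [inv_mul_cancel_right, not_not.mp hw, zero_add, e] at hmul
      rw [hmul, ← isRightDescent_iff_invParity_ne_zero, cs.isRightDescent_iff] at hinv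
      omega
    · have h1 := cs.length_mul_le (ωS * w⁻¹ * cs.simple i) (cs.simple i * w)
      have e : ωS * w⁻¹ * cs.simple i * (cs.simple i * w) = ωS := by simp [mul_assoc]
      have h2 := cs.length_mul_le (ωS * w⁻¹) (cs.simple i)
      rw [e] at h1
      rw [cs.length_simple] at h2
      omega

theorem wordProd_mem_parabolic (cs : CoxeterSystem M W) {J : Set B} {ω : List B}
    (hω : ∀ i ∈ ω, i ∈ J) : cs.wordProd ω ∈ parabolic cs J := by
  refine Subgroup.list_prod_mem _ fun x hx ↦ ?_
  obtain ⟨i, hi, rfl⟩ := List.mem_map.mp hx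
  exact Subgroup.subset_closure ⟨i, hω i hi, rfl⟩

theorem exists_wordProd_of_mem_parabolic {cs : CoxeterSystem M W} {J : Set B} {u : W}
    (hu : u ∈ parabolic cs J) : ∃ ω : List B, (∀ i ∈ ω, i ∈ J) ∧ cs.wordProd ω = u := by
  induction hu using Subgroup.closure_induction with
  | mem x hx =>
    obtain ⟨i, hi, rfl⟩ := hx
    exact ⟨[i], by simpa using hi, by simp⟩
  | one => exact ⟨[], by simp, by simp⟩
  | mul x y _ _ hx hy =>
    obtain ⟨ω, hω, rfl⟩ := hx
    obtain ⟨ω', hω', rfl⟩ := hy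
    refine ⟨ω ++ ω', fun i hi ↦ ?_, cs.wordProd_append ω ω'⟩
    exact (List.mem_append.mp hi).elim (hω i) (hω' i)
  | inv x _ hx =>
    obtain ⟨ω, hω, rfl⟩ := hx
    exact ⟨ω.reverse, by simpa using hω, by simp⟩

theorem exists_rightDescent_of_wordProd_ne_one (cs : CoxeterSystem M W) {J : Set B} (ω : List B)
    (hω : ∀ i ∈ ω, i ∈ J) (h1 : cs.wordProd ω ≠ 1) :
    ∃ i ∈ J, cs.IsRightDescent (cs.wordProd ω) i := by
  induction hn : ω.length using Nat.strong_induction_on generalizing ω with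
  | _ n ih =>
    rcases List.eq_nil_or_concat ω with rfl | ⟨ω', i, rfl⟩
    · simp at h1
    have hi : i ∈ J := hω i (by simp)
    by_cases hdes : cs.IsRightDescent (cs.wordProd (ω'.concat i)) i
    · exact ⟨i, hi, hdes⟩
    rw [cs.wordProd_concat] at hdes h1 ⊢
    rw [← cs.isRightDescent_iff_not_isRightDescent_mul,
      ← cs.isRightInversion_simple_iff_isRightDescent] at hdes
    obtain ⟨j, hj, he⟩ := exists_mul_eq_wordProd_eraseIdx hdes
    rw [he] at h1 ⊢
    refine ih _ ?_ (ω'.eraseIdx j) (fun k hk ↦ hω k ?_) h1 rfl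
    · rw [← hn, List.length_concat]
      exact Nat.lt_succ_of_le (List.length_eraseIdx_le ω' j)
    · simp [List.mem_of_mem_eraseIdx hk]

theorem length_mul_of_forall_length_le {cs : CoxeterSystem M W} {J : Set B} {w u : W}
    (hw : ∀ v ∈ parabolic cs J, cs.length w ≤ cs.length (w * v)) (hu : u ∈ parabolic cs J) :
    cs.length (w * u) = cs.length w + cs.length u := by
  obtain ⟨ω, hω, rfl⟩ := exists_wordProd_of_mem_parabolic hu
  clear hu
  induction ω using List.reverseRecOn with
  | nil => simp
  | append_singleton ω i ih =>
    have ih := ih fun k hk ↦ hω k (by simp [hk])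
    have hmem : cs.wordProd ω ∈ parabolic cs J :=
      wordProd_mem_parabolic cs fun k hk ↦ hω k (by simp [hk])
    have hi : cs.simple i ∈ parabolic cs J :=
      Subgroup.subset_closure ⟨i, hω i (by simp), rfl⟩
    rw [cs.wordProd_append, cs.wordProd_singleton]
    generalize cs.wordProd ω = u at *
    have ht : cs.IsReflection (u * cs.simple i * u⁻¹) := ⟨u, i, rfl⟩
    have h0 : invParity cs w (u * cs.simple i * u⁻¹) = 0 := by
      by_contra h
      exact (isRightInversion_of_invParity_ne_zero h).2.not_ge
        (hw _ (mul_mem (mul_mem hmem hi) (inv_mem hmem)))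
    have hiff : cs.IsRightDescent (w * u) i ↔ cs.IsRightDescent u i := by
      rw [isRightDescent_iff_invParity_ne_zero, isRightDescent_iff_invParity_ne_zero,
        invParity_mul, h0, add_zero]
    rw [← mul_assoc]
    by_cases h : cs.IsRightDescent u i
    · have h' := hiff.mpr h
      rw [cs.isRightDescent_iff] at h h'
      omega
    · have h' := mt hiff.mp h
      rw [cs.not_isRightDescent_iff] at h h'
      omega

theorem length_le_length_mul_of_mem_solomon {cs : CoxeterSystem M W} {J : Set B} {w : W}
    (hw : w ∈ solomon cs J) : ∀ v ∈ parabolic cs J, cs.length w ≤ cs.length (w * v) := by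
  obtain ⟨v, hv, hmin⟩ := WellFounded.has_min
    (InvImage.wf (fun v ↦ cs.length (w * v)) wellFounded_lt)
    (parabolic cs J : Set W) ⟨1, one_mem _⟩
  have hle : ∀ u ∈ parabolic cs J, cs.length (w * v) ≤ cs.length (w * v * u) := fun u hu ↦ by
    rw [mul_assoc]
    exact not_lt.mp (hmin _ (mul_mem hv hu))
  obtain ⟨ω, hω, hωv⟩ := exists_wordProd_of_mem_parabolic (inv_mem hv)
  have hv1 : v⁻¹ = 1 := by
    by_contra hne
    obtain ⟨i, hi, hdes⟩ := exists_rightDescent_of_wordProd_ne_one cs ω hω (hωv ▸ hne)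
    rw [hωv, CoxeterSystem.IsRightDescent] at hdes
    have hs : cs.simple i ∈ parabolic cs J := Subgroup.subset_closure ⟨i, hi, rfl⟩
    have h1 := length_mul_of_forall_length_le hle (inv_mem hv)
    have h2 := length_mul_of_forall_length_le hle (mul_mem (inv_mem hv) hs)
    rw [← mul_assoc, mul_inv_cancel_right] at h2
    rw [mul_inv_cancel_right] at h1
    have h3 := hw i hi
    omega
  rw [inv_eq_one] at hv1
  simpa [hv1] using hle

theorem solomon_eq_weak_interval [Finite W] (cs : CoxeterSystem M W) (J : Set B)
    (ωS ωJ ξJ : W)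
    (hS : ∀ w : W, cs.length w ≤ cs.length ωS)
    (hJmem : ωJ ∈ parabolic cs J)
    (hJmax : ∀ w ∈ parabolic cs J, cs.length w ≤ cs.length ωJ)
    (hξ : ξJ ∈ solomon cs J)
    (hdec : ωS = ξJ * ωJ) :
    solomon cs J = {w : W | weakLE cs w ξJ} := by
  ext w
  constructor
  · intro hw
    have h1 := length_eq_add_of_forall_length_le cs hS (w * ωJ)
    have h2 := length_eq_add_of_forall_length_le cs hS ωJ
    rw [length_mul_of_forall_length_le (length_le_length_mul_of_mem_solomon hw) hJmem] at h1
    have e1 : ωS * (w * ωJ)⁻¹ = ξJ * w⁻¹ := by rw [hdec]; group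
    have e2 : ωS * ωJ⁻¹ = ξJ := by rw [hdec]; group
    rw [e1] at h1
    rw [e2] at h2
    exact ⟨ξJ * w⁻¹, by group, by omega⟩
  · rintro ⟨y, hy, hlen⟩ i hi
    have h1 := hξ i hi
    have h2 := cs.length_mul_le y (w * cs.simple i)
    rw [← mul_assoc, ← hy] at h2
    omega

end PaperWeakBruhat
end

section
/- Identify each γ ∈ P_{n,r} with the right coclass Ψ^{-1}(γ) of a Young subgroup of S_n. Then: (1) for γ ∈ P_{n,r} and δ ∈ P_{n,s}, the coclass Ψ^{-1}(γ) is contained in the coclass Ψ^{-1}(δ) if and only if there exists a non-decreasing surjection ρ ∈ P_{r,s} such that δ = ρ∘γ; and (2) the weak Bruhat order on the set of right coclasses of Young subgroups of S_n (defined via the relations W_J∘w <_B W_{J∪{s}}∘w and W_{J∪{s}}∘w <_B W_J∘(α_{J,s}^{-1}∘w)) corresponds, under Ψ, to the reflexive-transitive closure of the relations: γ <_B t_i∘γ whenever every element of γ^{-1}(i) is smaller than every element of γ^{-1}(i+1), and t_i∘γ <_B γ whenever every element of γ^{-1}(i) is larger than every element of γ^{-1}(i+1), for γ ∈ P_{n,r}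 and 1 ≤ i ≤ r−1. -/
namespace PaperP

/-- `IsPF n r f` : `f` represents a surjective map `{1,…,n} → {1,…,r}` (an element of
`P_{n,r}`), normalized so that `f v = 0` for `v ∉ {1,…,n}`. -/
def IsPF (n r : ℕ) (f : ℕ → ℕ) : Prop :=
  (∀ v : ℕ, f v ≠ 0 ↔ (1 ≤ v ∧ v ≤ n)) ∧ f '' Set.Icc 1 n = Set.Icc 1 r

/-- The product `γ × δ ∈ P_{n+m,r+s}` of `γ ∈ P_{n,r}` and `δ ∈ P_{m,s}`:
`(γ×δ)(i) = γ(i)` for `1 ≤ i ≤ n` and `(γ×δ)(n+i) = δ(i)+r` for `1 ≤ i ≤ m`. -/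
def prodF (n r : ℕ) (f g : ℕ → ℕ) : ℕ → ℕ := fun v =>
  if v ≤ n then f v else if g (v - n) = 0 then 0 else g (v - n) + r

/-- The identity map `1_r` of `{1,…,r}`. -/
def idF (r : ℕ) : ℕ → ℕ := fun v => if 1 ≤ v ∧ v ≤ r then v else 0

/-- The map `t_i ∈ P_{r,r-1}` : `t_i(j) = j` for `j ≤ i` and `t_i(j) = j-1` for `j > i`. -/
def tF (r i : ℕ) : ℕ → ℕ := fun v =>
  if 1 ≤ v ∧ v ≤ r then (if v ≤ i then v else v - 1) else 0

/-- The block-increasing condition: `γ` is increasing on each of the consecutive blocks of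
sizes `ns = (n₁,…,n_r)` (positions are 1-based). -/
def BlockIncr (ns : List ℕ) (f : ℕ → ℕ) : Prop :=
  ∀ j < ns.length, ∀ a b : ℕ, (ns.take j).sum < a → a < b → b ≤ (ns.take (j + 1)).sum →
    f a < f b

/-- Membership in the set of shuffles `SH(n₁,…,n_r) ⊆ P_n`, `n = n₁+…+n_r`. -/
def InSH (ns : List ℕ) (f : ℕ → ℕ) : Prop :=
  (∃ r : ℕ, IsPF ns.sum r f) ∧ BlockIncr ns f

/-- `γ⁻¹(i) < γ⁻¹(i+1)` : every element of `γ⁻¹(i)` is smaller than every element of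
`γ⁻¹(i+1)`. -/
def InvIncr (f : ℕ → ℕ) (i : ℕ) : Prop := ∀ a b : ℕ, f a = i → f b = i + 1 → a < b

/-- `γ⁻¹(i) > γ⁻¹(i+1)` : every element of `γ⁻¹(i)` is larger than every element of
`γ⁻¹(i+1)`. -/
def InvDecr (f : ℕ → ℕ) (i : ℕ) : Prop := ∀ a b : ℕ, f a = i → f b = i + 1 → b < a

/-- One covering step of the weak Bruhat order on `P_n` :
`γ <_B t_i ∘ γ` when `γ⁻¹(i) < γ⁻¹(i+1)`, and `t_i ∘ γ <_B γ` when `γ⁻¹(i) > γ⁻¹(i+1)`,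
for `γ ∈ P_{n,r}` and `1 ≤ i ≤ r-1`. -/
def BStep (n : ℕ) (f g : ℕ → ℕ) : Prop :=
  ∃ r i : ℕ, 1 ≤ i ∧ i + 1 ≤ r ∧
    ((IsPF n r f ∧ InvIncr f i ∧ g = tF r i ∘ f) ∨
     (IsPF n r g ∧ InvDecr g i ∧ f = tF r i ∘ g))

/-- The weak Bruhat order `≤_B` on `P_n`, the reflexive-transitive closure of `BStep`. -/
def BLE (n : ℕ) : (ℕ → ℕ) → (ℕ → ℕ) → Prop := Relation.ReflTransGen (BStep n)

/-- Turn a (1-based) list of values into a normalized map `ℕ → ℕ`. -/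
def ofList (l : List ℕ) : ℕ → ℕ := fun v => if v = 0 then 0 else l.getD (v - 1) 0

/-- The maximal shuffle `ξ_{n₁,…,n_r}` :
`ξ(k) = k - (n₁+…+n_{j-1}) + (n_{j+1}+…+n_r)` for `n₁+…+n_{j-1} < k ≤ n₁+…+n_j`. -/
def xiF : List ℕ → ℕ → ℕ
  | [], _ => 0
  | m :: rest, k =>
      if k = 0 then 0 else if k ≤ m then k + rest.sum else xiF rest (k - m)

/-- The list `z(n₀,…,n_k) = (1,…,n₀, n+1, n₀+1,…,n₀+n₁, n+1, …, n+1, n₀+…+n_{k-1}+1,…,n)`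
where `n = n₀+…+n_k` (built with an accumulator `start`). -/
def zList (n : ℕ) : ℕ → List ℕ → List ℕ
  | _, [] => []
  | start, [m] => List.range' (start + 1) m
  | start, m :: rest => List.range' (start + 1) m ++ (n + 1) :: zList n (start + m) rest

/-- `z(n₀,…,n_k)` as a normalized map. -/
def zF (ns : List ℕ) : ℕ → ℕ := ofList (zList ns.sum 0 ns)

/-- The iterated product `γ₀ × … × γ_k` of a family, each member given as a triple
`(nᵢ, rᵢ, γᵢ)` with `γᵢ ∈ P_{nᵢ,rᵢ}`; returns `(Σnᵢ, Σrᵢ, γ₀×…×γ_k)`. -/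
def prodFam : List (ℕ × ℕ × (ℕ → ℕ)) → ℕ × ℕ × (ℕ → ℕ)
  | [] => (0, 0, fun _ => 0)
  | (n, r, f) :: rest =>
      let p := prodFam rest
      (n + p.1, r + p.2.1, prodF n r f p.2.2)

/-- The wedge `⋁_ω(γ₀,…,γ_k) = ((ω ∘ (γ₀×…×γ_k)) × 1₁) ∘ z(n₀,…,n_k)` of a family
`γᵢ ∈ P_{nᵢ,rᵢ}` over a shuffle `ω ∈ SH(r₀,…,r_k)`. -/
def wedgeF (ω : ℕ → ℕ) (fam : List (ℕ × ℕ × (ℕ → ℕ))) : ℕ → ℕ :=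
  prodF (prodFam fam).1 (prodFam fam).2.1 (ω ∘ (prodFam fam).2.2) (idF 1) ∘
    zF (fam.map (·.1))

/-- The simple transposition `s_i = (i, i+1)` of `S_n` (0-based indices in `Fin n`). -/
def simpleS (n : ℕ) (i : Fin (n - 1)) : Equiv.Perm (Fin n) :=
  Equiv.swap ⟨(i : ℕ), by have := i.isLt; omega⟩ ⟨(i : ℕ) + 1, by have := i.isLt; omega⟩

/-- The Coxeter length of a permutation: the least length of an expression as a product of
simple transpositions. -/
noncomputable def lenS (n : ℕ) (w : Equiv.Perm (Fin n)) : ℕ :=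
  sInf {k : ℕ | ∃ l : List (Fin (n - 1)), l.length = k ∧ (l.map (simpleS n)).prod = w}

/-- The standard parabolic subgroup `W_J` of `S_n`. -/
def parabolicS (n : ℕ) (J : Set (Fin (n - 1))) : Subgroup (Equiv.Perm (Fin n)) :=
  Subgroup.closure (simpleS n '' J)

/-- The Solomon subset `X_J ⊆ S_n`. -/
noncomputable def solomonS (n : ℕ) (J : Set (Fin (n - 1))) : Set (Equiv.Perm (Fin n)) :=
  {w : Equiv.Perm (Fin n) | ∀ i ∈ J, lenS n w < lenS n (w * simpleS n i)}

/-- The right coclass `W_J ∘ w ⊆ S_n`. -/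
def coclassS (n : ℕ) (J : Set (Fin (n - 1))) (w : Equiv.Perm (Fin n)) :
    Set (Equiv.Perm (Fin n)) :=
  {x : Equiv.Perm (Fin n) | ∃ p ∈ parabolicS n J, x = p * w}

/-- The generating relations of the weak Bruhat order on the right coclasses of standard
parabolic (= Young) subgroups of `S_n`:
(1) `W_J ∘ w <_B W_{J∪{s}} ∘ w` and (2) `W_{J∪{s}} ∘ w <_B W_J ∘ (α_{J,s}⁻¹ ∘ w)`, for
`s ∉ J` and `w ∈ X_{J∪{s}}⁻¹`, where `α_{J,s} = ξ_{J∪{s}}⁻¹ ∘ ξ_J` and `ξ : J ↦ ξ_J` is the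
family of maximal-length elements of the Solomon sets. -/
noncomputable def pRelS (n : ℕ) (ξ : Set (Fin (n - 1)) → Equiv.Perm (Fin n)) :
    Set (Equiv.Perm (Fin n)) → Set (Equiv.Perm (Fin n)) → Prop := fun A C =>
  ∃ (J : Set (Fin (n - 1))) (s : Fin (n - 1)) (w : Equiv.Perm (Fin n)),
    s ∉ J ∧ w⁻¹ ∈ solomonS n (J ∪ {s}) ∧
    ((A = coclassS n J w ∧ C = coclassS n (J ∪ {s}) w) ∨
     (A = coclassS n (J ∪ {s}) w ∧
        C = coclassS n J (((ξ (J ∪ {s}))⁻¹ * ξ J)⁻¹ * w)))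

/-- The right coclass of the Young subgroup of a composition `c` of `n`. -/
def youngCoclass {n : ℕ} (c : Composition n) (σ : Equiv.Perm (Fin n)) :
    Set (Equiv.Perm (Fin n)) :=
  {x : Equiv.Perm (Fin n) |
    ∃ p : Equiv.Perm (Fin n), (∀ i : Fin n, c.index (p i) = c.index i) ∧ x = p * σ}

/-- The bijection `Ψ` : `Ψ(S_{n₁,…,n_r} ∘ σ)(i) = j` whenever
`n₁+…+n_{j-1} < σ(i) ≤ n₁+…+n_j` (1-based, normalized to `0` outside `{1,…,n}`). -/
def psiF {n : ℕ} (c : Composition n) (σ : Equiv.Perm (Fin n)) : ℕ → ℕ := fun v =>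
  if h : 1 ≤ v ∧ v ≤ n then (c.index (σ ⟨v - 1, by omega⟩) : ℕ) + 1 else 0


/-! ### Lengths and inversions in the symmetric group -/

theorem perm_apply_inv_self {α : Type*} (w : Equiv.Perm α) (a : α) : w (w⁻¹ a) = a :=
  Equiv.apply_symm_apply w a

theorem perm_inv_apply_self {α : Type*} (w : Equiv.Perm α) (a : α) : w⁻¹ (w a) = a :=
  Equiv.symm_apply_apply w a

/-- The left index `i` moved by the simple transposition `s_i`. -/
def loS {n : ℕ} (s : Fin (n - 1)) : Fin n := ⟨s, by have := s.isLt; omega⟩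

/-- The right index `i + 1` moved by the simple transposition `s_i`. -/
def hiS {n : ℕ} (s : Fin (n - 1)) : Fin n := ⟨s + 1, by have := s.isLt; omega⟩

theorem loS_val {n : ℕ} (s : Fin (n - 1)) : (loS s : ℕ) = s := rfl

theorem hiS_val {n : ℕ} (s : Fin (n - 1)) : (hiS s : ℕ) = s + 1 := rfl

theorem simpleS_eq_swap {n : ℕ} (s : Fin (n - 1)) : simpleS n s = Equiv.swap (loS s) (hiS s) :=
  rfl

theorem simpleS_lo {n : ℕ} (s : Fin (n - 1)) : simpleS n s (loS s) = hiS s :=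
  Equiv.swap_apply_left _ _

theorem simpleS_hi {n : ℕ} (s : Fin (n - 1)) : simpleS n s (hiS s) = loS s :=
  Equiv.swap_apply_right _ _

theorem simpleS_mul_self {n : ℕ} (s : Fin (n - 1)) : simpleS n s * simpleS n s = 1 :=
  Equiv.swap_mul_self _ _

theorem loS_ne_hiS {n : ℕ} (s : Fin (n - 1)) : loS s ≠ hiS s := by
  simp [loS, hiS]

/-- The set of inversions of a permutation. -/
def invSet {n : ℕ} (w : Equiv.Perm (Fin n)) : Finset (Fin n × Fin n) :=
  Finset.univ.filter fun p => p.1 < p.2 ∧ w p.2 < w p.1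

theorem mem_invSet {n : ℕ} (w : Equiv.Perm (Fin n)) (a b : Fin n) :
    (a, b) ∈ invSet w ↔ a < b ∧ w b < w a := by
  simp [invSet]

theorem card_invSet_mul_simpleS {n : ℕ} (w : Equiv.Perm (Fin n)) (s : Fin (n - 1))
    (h : w (loS s) < w (hiS s)) :
    (invSet (w * simpleS n s)).card = (invSet w).card + 1 := by
  have key : invSet (w * simpleS n s) = insert (loS s, hiS s)
      ((invSet w).map (Equiv.prodCongr (simpleS n s) (simpleS n s)).toEmbedding) := by
    ext ⟨a, b⟩
    have hs : (simpleS n s).symm = simpleS n s := Equiv.symm_swap _ _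
    simp only [mem_invSet, Finset.mem_insert, Finset.mem_map_equiv, Equiv.prodCongr_symm, Equiv.prodCongr_apply, Prod.map, hs,
      Equiv.Perm.mul_apply, Prod.mk.injEq]
    have e : ∀ a, simpleS n s a = if a = loS s then hiS s else if a = hiS s then loS s else a :=
      fun a => Equiv.swap_apply_def _ _ _
    rw [e a, e b]
    split_ifs <;> subst_vars <;> simp only [Fin.lt_def, Fin.ext_iff, loS_val, hiS_val] at * <;>
      first | omega | simp [h]
  rw [key, Finset.card_insert_of_notMem, Finset.card_map]
  simp only [Finset.mem_map_equiv, Equiv.prodCongr_symm, Equiv.prodCongr_apply, Prod.map]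
  have hs : (simpleS n s).symm = simpleS n s := Equiv.symm_swap _ _
  rw [hs, simpleS_lo, simpleS_hi, mem_invSet]
  exact fun h' => absurd (Fin.lt_def.1 h'.1) (by simp [loS, hiS])

theorem card_invSet_mul_simpleS_of_gt {n : ℕ} (w : Equiv.Perm (Fin n)) (s : Fin (n - 1))
    (h : w (hiS s) < w (loS s)) :
    (invSet (w * simpleS n s)).card + 1 = (invSet w).card := by
  have := card_invSet_mul_simpleS (w * simpleS n s) s (by
    simpa [Equiv.Perm.mul_apply, simpleS_lo, simpleS_hi] using h)
  rw [mul_assoc, simpleS_mul_self, mul_one] at this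
  exact this.symm

theorem lt_or_gt_loS_hiS {n : ℕ} (w : Equiv.Perm (Fin n)) (s : Fin (n - 1)) :
    w (loS s) < w (hiS s) ∨ w (hiS s) < w (loS s) :=
  lt_or_gt_of_ne fun h => loS_ne_hiS s (w.injective h)

theorem eq_one_of_forall_lt {n : ℕ} (w : Equiv.Perm (Fin n))
    (h : ∀ s : Fin (n - 1), w (loS s) < w (hiS s)) : w = 1 := by
  have hm : StrictMono w := by
    rcases n with _ | n
    · exact fun a => a.elim0
    · exact Fin.strictMono_iff_lt_succ.2 fun i => h i
  ext i
  have := Subsingleton.elim (hm.orderIsoOfSurjective w w.surjective) (OrderIso.refl (Fin n))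
  exact congrArg Fin.val (congrArg (fun f : Fin n ≃o Fin n => f i) this)

theorem card_invSet_prod_le {n : ℕ} (l : List (Fin (n - 1))) :
    ∀ w : Equiv.Perm (Fin n), (invSet (w * (l.map (simpleS n)).prod)).card
      ≤ (invSet w).card + l.length := by
  induction l with
  | nil => simp
  | cons s l ih =>
    intro w
    rw [List.map_cons, List.prod_cons, ← mul_assoc, List.length_cons]
    have h1 := ih (w * simpleS n s)
    rcases lt_or_gt_loS_hiS w s with h | h
    · have := card_invSet_mul_simpleS w s h; omega
    · have := card_invSet_mul_simpleS_of_gt w s h; omega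

theorem invSet_one {n : ℕ} : invSet (1 : Equiv.Perm (Fin n)) = ∅ := by
  ext ⟨a, b⟩
  simp only [mem_invSet, Equiv.Perm.one_apply, Finset.notMem_empty, iff_false]
  exact fun h => lt_asymm h.1 h.2

theorem exists_word_length_eq_card_invSet {n : ℕ} (w : Equiv.Perm (Fin n)) :
    ∃ l : List (Fin (n - 1)), l.length = (invSet w).card ∧ (l.map (simpleS n)).prod = w := by
  induction hk : (invSet w).card generalizing w with
  | zero =>
    refine ⟨[], rfl, (eq_one_of_forall_lt w fun s => ?_).symm⟩
    rcases lt_or_gt_loS_hiS w s with h | h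
    · exact h
    · have := card_invSet_mul_simpleS_of_gt w s h; omega
  | succ k ih =>
    have hne : ∃ s : Fin (n - 1), w (hiS s) < w (loS s) := by
      by_contra! hc
      have : w = 1 := eq_one_of_forall_lt w fun s =>
        (lt_or_gt_loS_hiS w s).resolve_right (hc s).not_gt
      simp [this, invSet_one] at hk
    obtain ⟨s, hs⟩ := hne
    have hc := card_invSet_mul_simpleS_of_gt w s hs
    obtain ⟨l, hl, hp⟩ := ih (w * simpleS n s) (by omega)
    exact ⟨l ++ [s], by simp [hl], by simp [hp, mul_assoc, simpleS_mul_self]⟩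

theorem lenS_eq_card_invSet {n : ℕ} (w : Equiv.Perm (Fin n)) : lenS n w = (invSet w).card := by
  apply le_antisymm
  · exact Nat.sInf_le (exists_word_length_eq_card_invSet w)
  · refine le_csInf ⟨_, exists_word_length_eq_card_invSet w⟩ ?_
    rintro k ⟨l, rfl, rfl⟩
    simpa [invSet_one] using card_invSet_prod_le l 1

theorem lenS_lt_lenS_mul_simpleS_iff {n : ℕ} (w : Equiv.Perm (Fin n)) (s : Fin (n - 1)) :
    lenS n w < lenS n (w * simpleS n s) ↔ w (loS s) < w (hiS s) := by
  rw [lenS_eq_card_invSet, lenS_eq_card_invSet]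
  rcases lt_or_gt_loS_hiS w s with h | h
  · have := card_invSet_mul_simpleS w s h
    exact iff_of_true (by omega) h
  · have := card_invSet_mul_simpleS_of_gt w s h
    exact iff_of_false (by omega) h.not_gt

theorem mem_solomonS_iff {n : ℕ} (J : Set (Fin (n - 1))) (w : Equiv.Perm (Fin n)) :
    w ∈ solomonS n J ↔ ∀ s ∈ J, w (loS s) < w (hiS s) :=
  forall₂_congr fun s _ => lenS_lt_lenS_mul_simpleS_iff w s

/-! ### Block indices -/

open Classical in
/-- The index of the block containing `k` for the partition of `{0, …, n-1}` into the
consecutive blocks whose interior steps `i, i+1` are the elements of `J`. -/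
noncomputable def blockIdx {n : ℕ} (J : Set (Fin (n - 1))) : ℕ → ℕ
  | 0 => 0
  | k + 1 => blockIdx J k + if ∃ h : k < n - 1, (⟨k, h⟩ : Fin (n - 1)) ∈ J then 0 else 1

theorem blockIdx_succ_of_mem {n : ℕ} {J : Set (Fin (n - 1))} {s : Fin (n - 1)} (h : s ∈ J) :
    blockIdx J (s + 1) = blockIdx J s := by
  rw [blockIdx, if_pos ⟨s.isLt, h⟩, add_zero]

theorem blockIdx_succ_of_notMem {n : ℕ} {J : Set (Fin (n - 1))} {s : Fin (n - 1)} (h : s ∉ J) :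
    blockIdx J (s + 1) = blockIdx J s + 1 := by
  rw [blockIdx, if_neg fun ⟨_, h'⟩ => h h']

theorem blockIdx_succ_eq_iff {n : ℕ} (J : Set (Fin (n - 1))) (s : Fin (n - 1)) :
    blockIdx J (s + 1) = blockIdx J s ↔ s ∈ J := by
  by_cases h : s ∈ J
  · exact iff_of_true (blockIdx_succ_of_mem h) h
  · rw [blockIdx_succ_of_notMem h]
    exact iff_of_false (by omega) h

theorem blockIdx_mono {n : ℕ} (J : Set (Fin (n - 1))) : Monotone (blockIdx J) :=
  monotone_nat_of_le_succ fun k => by rw [blockIdx]; omega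

theorem exists_blockIdx_eq {n : ℕ} (J : Set (Fin (n - 1))) (k : ℕ) :
    ∀ m ≤ blockIdx J k, ∃ j ≤ k, blockIdx J j = m := by
  induction k with
  | zero => exact fun m hm => ⟨0, le_rfl, by simpa [blockIdx, eq_comm] using hm⟩
  | succ k ih =>
    intro m hm
    by_cases h : m ≤ blockIdx J k
    · obtain ⟨j, hj, e⟩ := ih m h
      exact ⟨j, by omega, e⟩
    · refine ⟨k + 1, le_rfl, ?_⟩
      rw [blockIdx] at hm ⊢
      split_ifs at hm ⊢ <;> omega

/-- Every positive block index is first reached by a step outside `J`. -/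
theorem exists_notMem_blockIdx_eq {n : ℕ} (J : Set (Fin (n - 1))) (m : ℕ) :
    ∀ k < n, m + 1 ≤ blockIdx J k → ∃ s : Fin (n - 1), s ∉ J ∧ blockIdx J s = m := by
  intro k
  induction k with
  | zero => intro _ h; simp [blockIdx] at h
  | succ k ih =>
    intro hk h
    by_cases h' : m + 1 ≤ blockIdx J k
    · exact ih (by omega) h'
    · let s : Fin (n - 1) := ⟨k, by omega⟩
      by_cases hs : s ∈ J
      · have : blockIdx J (k + 1) = blockIdx J k := blockIdx_succ_of_mem hs
        omega
      · have : blockIdx J (k + 1) = blockIdx J k + 1 := blockIdx_succ_of_notMem hs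
        exact ⟨s, hs, by change blockIdx J k = m; omega⟩

theorem blockIdx_insert {n : ℕ} {J : Set (Fin (n - 1))} {s : Fin (n - 1)} (hs : s ∉ J) (k : ℕ) :
    blockIdx (J ∪ {s}) k = if k ≤ s then blockIdx J k else blockIdx J k - 1 := by
  induction k with
  | zero => simp [blockIdx]
  | succ k ih =>
    have hpos : s < k → 1 ≤ blockIdx J k := fun h => by
      have := blockIdx_mono J (Nat.succ_le_of_lt h)
      have e := blockIdx_succ_of_notMem hs
      simp only [Nat.succ_eq_add_one] at this
      omega
    by_cases hk : k = s
    · subst hk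
      rw [if_pos le_rfl] at ih
      rw [if_neg (by omega), blockIdx_succ_of_mem (by simp), blockIdx_succ_of_notMem hs, ih]
      omega
    · have hiff : (∃ h : k < n - 1, (⟨k, h⟩ : Fin (n - 1)) ∈ J ∪ {s}) ↔
          ∃ h : k < n - 1, (⟨k, h⟩ : Fin (n - 1)) ∈ J :=
        exists_congr fun _ => by simp [Fin.ext_iff, hk]
      by_cases hJ : ∃ h : k < n - 1, (⟨k, h⟩ : Fin (n - 1)) ∈ J
      · rw [blockIdx, blockIdx, if_pos hJ, if_pos (hiff.2 hJ), ih]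
        split_ifs <;> omega
      · rw [blockIdx, blockIdx, if_neg hJ, if_neg (mt hiff.1 hJ), ih]
        split_ifs <;> omega

/-- A monotone map from `Fin n` onto an initial segment of `ℕ` is a block index map. -/
theorem eq_blockIdx_of_monotone {n : ℕ} {g : Fin n → ℕ} (hg : Monotone g)
    (hr : ∀ k, ∀ m ≤ g k, ∃ j, g j = m) :
    ∀ k : Fin n, g k = blockIdx {s : Fin (n - 1) | g (loS s) = g (hiS s)} k := by
  rintro ⟨k, hk⟩
  induction k with
  | zero =>
    obtain ⟨j, hj⟩ := hr ⟨0, hk⟩ 0 (Nat.zero_le _)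
    have : g ⟨0, hk⟩ ≤ g j := hg (Nat.zero_le _)
    simp only [blockIdx]
    omega
  | succ k ih =>
    have ih := ih (by omega)
    let s : Fin (n - 1) := ⟨k, by omega⟩
    have hle : g (loS s) ≤ g (hiS s) := hg (by simp [Fin.le_def, loS, hiS])
    change g (hiS s) = _
    change g (loS s) = _ at ih
    by_cases h : g (loS s) = g (hiS s)
    · rw [← h, ih]
      exact (blockIdx_succ_of_mem (s := s) h).symm
    · refine Eq.trans ?_ (blockIdx_succ_of_notMem (s := s) h).symm
      refine Eq.trans ?_ (congrArg (· + 1) ih)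
      obtain ⟨j, hj⟩ := hr (hiS s) (g (loS s) + 1) (by omega)
      rcases le_or_gt j (loS s) with hj' | hj'
      · have := hg hj'; omega
      · have : hiS s ≤ j := hj'
        have := hg this
        omega

/-- The block index determines `J`. -/
theorem eq_of_blockIdx_eq {n : ℕ} {J K : Set (Fin (n - 1))}
    (h : ∀ k : Fin n, blockIdx J k = blockIdx K k) : J = K := by
  ext s
  rw [← blockIdx_succ_eq_iff J, ← blockIdx_succ_eq_iff K]
  have h1 := h (loS s)
  have h2 := h (hiS s)
  rw [loS_val] at h1
  rw [hiS_val] at h2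
  rw [h1, h2]

/-- A transitive relation holding along the steps in `J` holds along each block. -/
theorem rel_of_blockIdx_eq {n : ℕ} {J : Set (Fin (n - 1))} {R : Fin n → Fin n → Prop}
    (htrans : ∀ a b c, R a b → R b c → R a c) (hstep : ∀ s ∈ J, R (loS s) (hiS s))
    {a b : Fin n} (hab : a < b) (h : blockIdx J a = blockIdx J b) : R a b := by
  obtain ⟨b, hb⟩ := b
  induction b with
  | zero => exact absurd hab (Nat.not_lt_zero _)
  | succ b ih =>
    let s : Fin (n - 1) := ⟨b, by omega⟩
    have hab' : (a : ℕ) ≤ b := Nat.le_of_lt_succ hab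
    have h1 : blockIdx J a ≤ blockIdx J b := blockIdx_mono J hab'
    have h2 : blockIdx J b ≤ blockIdx J (b + 1) := blockIdx_mono J (Nat.le_succ b)
    have h3 : blockIdx J a = blockIdx J (b + 1) := h
    have hs : R (loS s) (hiS s) := hstep s ((blockIdx_succ_eq_iff J s).1 (by
      change blockIdx J (b + 1) = blockIdx J b; omega))
    rcases hab'.lt_or_eq with hlt | heq
    · exact htrans _ _ _ (ih (by omega) hlt (by change blockIdx J a = blockIdx J b; omega)) hs
    · have : a = loS s := Fin.ext heq
      rw [this]
      exact hs

theorem mem_parabolicS_iff {n : ℕ} (J : Set (Fin (n - 1))) (p : Equiv.Perm (Fin n)) :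
    p ∈ parabolicS n J ↔ ∀ a, blockIdx J (p a) = blockIdx J a := by
  constructor
  · intro hp
    induction hp using Subgroup.closure_induction with
    | mem x hx =>
      obtain ⟨s, hs, rfl⟩ := hx
      intro a
      have e : blockIdx J (hiS s) = blockIdx J (loS s) := blockIdx_succ_of_mem hs
      rw [simpleS_eq_swap, Equiv.swap_apply_def]
      split_ifs with h1 h2
      · rw [h1, e]
      · rw [h2, e]
      · rfl
    | one => exact fun _ => rfl
    | mul x y _ _ hx hy => exact fun a => (hx (y a)).trans (hy a)
    | inv x _ hx =>
      intro a
      simpa using (hx (x⁻¹ a)).symm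
  · induction hk : (invSet p).card generalizing p with
    | zero =>
      intro _
      have : p = 1 := eq_one_of_forall_lt p fun s =>
        (lt_or_gt_loS_hiS p s).resolve_right fun h => by
          have := card_invSet_mul_simpleS_of_gt p s h
          omega
      exact this ▸ one_mem _
    | succ k ih =>
      intro hp
      have hne : ∃ s : Fin (n - 1), p (hiS s) < p (loS s) := by
        by_contra! hc
        have : p = 1 := eq_one_of_forall_lt p fun s =>
          (lt_or_gt_loS_hiS p s).resolve_right (hc s).not_gt
        simp [this, invSet_one] at hk
      obtain ⟨s, hs⟩ := hne
      have hsJ : s ∈ J := by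
        rw [← blockIdx_succ_eq_iff]
        apply le_antisymm
        · rw [← hiS_val, ← loS_val, ← hp (hiS s), ← hp (loS s)]
          exact blockIdx_mono J hs.le
        · exact blockIdx_mono J (Nat.le_succ _)
      have hmem : simpleS n s ∈ parabolicS n J :=
        Subgroup.subset_closure (Set.mem_image_of_mem _ hsJ)
      have hc := card_invSet_mul_simpleS_of_gt p s hs
      have e : blockIdx J (hiS s) = blockIdx J (loS s) := blockIdx_succ_of_mem hsJ
      have := ih (p * simpleS n s) (by omega) fun a => by
        rw [Equiv.Perm.mul_apply, hp, simpleS_eq_swap, Equiv.swap_apply_def]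
        split_ifs with h1 h2
        · rw [h1, e]
        · rw [h2, e]
        · rfl
      exact (Subgroup.mul_mem_cancel_right _ hmem).1 this

theorem mem_coclassS_iff {n : ℕ} (J : Set (Fin (n - 1))) (w x : Equiv.Perm (Fin n)) :
    x ∈ coclassS n J w ↔ ∀ a, blockIdx J (x a) = blockIdx J (w a) := by
  constructor
  · rintro ⟨p, hp, rfl⟩ a
    exact (mem_parabolicS_iff J p).1 hp (w a)
  · intro h
    refine ⟨x * w⁻¹, (mem_parabolicS_iff J _).2 fun a => ?_, by simp⟩
    simpa using h (w⁻¹ a)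

/-- The image under `Ψ` of the right coclass `W_J ∘ w`. -/
noncomputable def blockMap {n : ℕ} (J : Set (Fin (n - 1))) (w : Equiv.Perm (Fin n)) : ℕ → ℕ :=
  fun v => if h : 1 ≤ v ∧ v ≤ n then blockIdx J (w ⟨v - 1, by omega⟩) + 1 else 0

theorem blockMap_succ {n : ℕ} (J : Set (Fin (n - 1))) (w : Equiv.Perm (Fin n)) (a : Fin n) :
    blockMap J w (a + 1) = blockIdx J (w a) + 1 := by
  have := a.isLt
  rw [blockMap, dif_pos ⟨by omega, by omega⟩]
  rfl

theorem exists_eq_succ {n v : ℕ} (h : 1 ≤ v ∧ v ≤ n) : ∃ a : Fin n, v = a + 1 :=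
  ⟨⟨v - 1, by omega⟩, by change v = v - 1 + 1; omega⟩

theorem blockMap_of_not {n v : ℕ} (J : Set (Fin (n - 1))) (w : Equiv.Perm (Fin n))
    (h : ¬(1 ≤ v ∧ v ≤ n)) : blockMap J w v = 0 :=
  dif_neg h

theorem exists_of_blockMap_eq_succ {n v m : ℕ} {J : Set (Fin (n - 1))} {w : Equiv.Perm (Fin n)}
    (h : blockMap J w v = m + 1) : ∃ a : Fin n, v = a + 1 ∧ blockIdx J (w a) = m := by
  by_cases hv : 1 ≤ v ∧ v ≤ n
  · obtain ⟨a, rfl⟩ := exists_eq_succ hv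
    rw [blockMap_succ] at h
    exact ⟨a, rfl, by omega⟩
  · rw [blockMap_of_not J w hv] at h
    omega

theorem eq_blockMap_iff {n : ℕ} {J : Set (Fin (n - 1))} {w : Equiv.Perm (Fin n)} {f : ℕ → ℕ}
    (hf : ∀ v, ¬(1 ≤ v ∧ v ≤ n) → f v = 0) :
    f = blockMap J w ↔ ∀ a : Fin n, f (a + 1) = blockIdx J (w a) + 1 := by
  constructor
  · rintro rfl a
    exact blockMap_succ J w a
  · intro h
    funext v
    by_cases hv : 1 ≤ v ∧ v ≤ n
    · obtain ⟨a, rfl⟩ := exists_eq_succ hv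
      rw [h, blockMap_succ]
    · rw [blockMap_of_not J w hv, hf v hv]

theorem blockMap_eq_iff {n : ℕ} {J K : Set (Fin (n - 1))} {w x : Equiv.Perm (Fin n)} :
    blockMap J w = blockMap K x ↔ ∀ a, blockIdx J (w a) = blockIdx K (x a) := by
  rw [eq_blockMap_iff fun v => blockMap_of_not J w]
  simp only [blockMap_succ, Nat.add_right_cancel_iff]

theorem eq_of_comp_perm_eq {n : ℕ} {f g : Fin n → ℕ} (hf : Monotone f) (hg : Monotone g)
    {σ τ : Equiv.Perm (Fin n)} (h : ∀ a, f (σ a) = g (τ a)) : f = g := by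
  have e : g = f ∘ (σ * τ⁻¹ : Equiv.Perm (Fin n)) := by
    funext a
    simpa using (h (τ⁻¹ a)).symm
  have := Tuple.unique_monotone (f := f) (σ := 1) (τ := σ * τ⁻¹) hf (e ▸ hg)
  rw [e, ← this]
  rfl

theorem blockIdx_comp_val_mono {n : ℕ} (J : Set (Fin (n - 1))) :
    Monotone fun k : Fin n => blockIdx J k :=
  fun _ _ h => blockIdx_mono J h

theorem coclassS_eq_iff {n : ℕ} {J K : Set (Fin (n - 1))} {w x : Equiv.Perm (Fin n)} :
    coclassS n J w = coclassS n K x ↔ blockMap J w = blockMap K x := by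
  constructor
  · intro h
    have hJK : ∀ p, p ∈ parabolicS n J ↔ p ∈ parabolicS n K := by
      have hw : w ∈ coclassS n K x := h ▸ (mem_coclassS_iff J w w).2 fun _ => rfl
      intro p
      have h1 : p * w ∈ coclassS n J w ↔ p ∈ parabolicS n J := by
        rw [mem_coclassS_iff, mem_parabolicS_iff]
        exact ⟨fun h a => by simpa using h (w⁻¹ a), fun h a => h (w a)⟩
      have h2 : p * w ∈ coclassS n K x ↔ p ∈ parabolicS n K := by
        rw [mem_coclassS_iff] at hw
        rw [mem_coclassS_iff, mem_parabolicS_iff]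
        simp only [← hw]
        exact ⟨fun h a => by simpa using h (w⁻¹ a), fun h a => h (w a)⟩
      rw [← h1, h, h2]
    have key : ∀ (L : Set (Fin (n - 1))) (s : Fin (n - 1)),
        simpleS n s ∈ parabolicS n L ↔ s ∈ L := fun L s => by
      refine ⟨fun hs => ?_, fun hs => Subgroup.subset_closure (Set.mem_image_of_mem _ hs)⟩
      have := (mem_parabolicS_iff L _).1 hs (loS s)
      rw [simpleS_lo] at this
      exact (blockIdx_succ_eq_iff L s).1 this
    have e : J = K := by
      ext s
      rw [← key J, hJK, key]
    subst e
    have hw : w ∈ coclassS n J x := h ▸ (mem_coclassS_iff J w w).2 fun _ => rfl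
    exact blockMap_eq_iff.2 ((mem_coclassS_iff J x w).1 hw)
  · intro h
    rw [blockMap_eq_iff] at h
    have e : J = K := eq_of_blockIdx_eq fun k =>
      congrFun (eq_of_comp_perm_eq (blockIdx_comp_val_mono J) (blockIdx_comp_val_mono K) h) k
    subst e
    ext y
    simp only [mem_coclassS_iff, h]

/-! ### Surjections as images of coclasses -/

theorem isPF_blockMap {n : ℕ} (hn : 1 ≤ n) (J : Set (Fin (n - 1))) (w : Equiv.Perm (Fin n)) :
    IsPF n (blockIdx J (n - 1) + 1) (blockMap J w) := by
  constructor
  · intro v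
    by_cases hv : 1 ≤ v ∧ v ≤ n
    · refine iff_of_true ?_ hv
      obtain ⟨a, rfl⟩ := exists_eq_succ hv
      rw [blockMap_succ]
      omega
    · exact iff_of_false (fun h => h (blockMap_of_not J w hv)) hv
  · ext m
    constructor
    · rintro ⟨v, hv, rfl⟩
      obtain ⟨a, rfl⟩ := exists_eq_succ hv
      rw [blockMap_succ]
      have : blockIdx J (w a) ≤ blockIdx J (n - 1) := blockIdx_mono J (by omega)
      exact ⟨by omega, by omega⟩
    · rintro ⟨h1, h2⟩
      obtain ⟨j, hj, e⟩ := exists_blockIdx_eq J (n - 1) (m - 1) (by omega)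
      have ha := (w⁻¹ ⟨j, by omega⟩ : Fin n).isLt
      refine ⟨(w⁻¹ ⟨j, by omega⟩ : Fin n) + 1, ⟨by omega, by omega⟩, ?_⟩
      rw [blockMap_succ, perm_apply_inv_self]
      change blockIdx J j + 1 = m
      omega

theorem IsPF.eq_zero {n r : ℕ} {f : ℕ → ℕ} (hf : IsPF n r f) {v : ℕ}
    (hv : ¬(1 ≤ v ∧ v ≤ n)) : f v = 0 :=
  not_not.1 (mt (hf.1 v).1 hv)

theorem IsPF.mem_Icc {n r : ℕ} {f : ℕ → ℕ} (hf : IsPF n r f) {v : ℕ}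
    (hv : 1 ≤ v ∧ v ≤ n) : 1 ≤ f v ∧ f v ≤ r :=
  hf.2.subset ⟨v, hv, rfl⟩

theorem IsPF.exists_eq {n r : ℕ} {f : ℕ → ℕ} (hf : IsPF n r f) {m : ℕ}
    (hm : 1 ≤ m ∧ m ≤ r) : ∃ a : Fin n, f (a + 1) = m := by
  obtain ⟨v, hv, e⟩ := hf.2.superset hm
  obtain ⟨a, rfl⟩ := exists_eq_succ hv
  exact ⟨a, e⟩

theorem IsPF.exists_eq_blockMap {n r : ℕ} {f : ℕ → ℕ} (hf : IsPF n r f) :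
    ∃ (J : Set (Fin (n - 1))) (w : Equiv.Perm (Fin n)), f = blockMap J w := by
  let σ := Tuple.sort fun a : Fin n => f (a + 1)
  have hmono : Monotone fun a : Fin n => f (σ a + 1) :=
    Tuple.monotone_sort fun a : Fin n => f (a + 1)
  have hb : ∀ a : Fin n, 1 ≤ f (a + 1) ∧ f (a + 1) ≤ r := fun a =>
    hf.mem_Icc ⟨by omega, by omega⟩
  obtain ⟨J, hJ⟩ : ∃ J : Set (Fin (n - 1)), ∀ k : Fin n, f (σ k + 1) - 1 = blockIdx J k :=
    ⟨_, eq_blockIdx_of_monotone (g := fun a => f (σ a + 1) - 1)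
      (fun a b h => Nat.sub_le_sub_right (hmono h) 1) (fun k m hm => by
        have := hb (σ k)
        obtain ⟨a, ha⟩ := hf.exists_eq (m := m + 1) ⟨by omega, by omega⟩
        exact ⟨σ⁻¹ a, by simp [ha]⟩)⟩
  refine ⟨J, σ⁻¹, (eq_blockMap_iff fun v => hf.eq_zero).2 fun a => ?_⟩
  have h := hJ (σ⁻¹ a)
  rw [perm_apply_inv_self] at h
  have := hb a
  omega

theorem tF_comp_blockMap {n r : ℕ} {J : Set (Fin (n - 1))} {s : Fin (n - 1)}
    {w : Equiv.Perm (Fin n)} (hs : s ∉ J) (hr : IsPF n r (blockMap J w)) :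
    tF r (blockIdx J s + 1) ∘ blockMap J w = blockMap (J ∪ {s}) w := by
  have h0 : ∀ v, ¬(1 ≤ v ∧ v ≤ n) → (tF r (blockIdx J s + 1) ∘ blockMap J w) v = 0 :=
    fun v hv => by simp [blockMap_of_not J w hv, tF]
  rw [eq_blockMap_iff h0]
  intro a
  have hb := hr.mem_Icc (v := a + 1) ⟨by omega, by omega⟩
  rw [Function.comp_apply, tF, if_pos hb, blockIdx_insert hs, blockMap_succ]
  by_cases h : (w a : ℕ) ≤ s
  · have := blockIdx_mono J h
    rw [if_pos h, if_pos (by omega)]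
  · have h1 := blockIdx_mono J (Nat.succ_le_of_lt (not_le.1 h))
    have h2 := blockIdx_succ_of_notMem hs
    simp only [Nat.succ_eq_add_one] at h1
    rw [if_neg h, if_neg (by omega)]
    omega

/-- The blocks `i` and `i + 1` merged by adding the step `s`. -/
theorem exists_step_of_isPF {n r i : ℕ} {J : Set (Fin (n - 1))} {w : Equiv.Perm (Fin n)}
    (hr : IsPF n r (blockMap J w)) (h1 : 1 ≤ i) (h2 : i + 1 ≤ r) :
    ∃ s : Fin (n - 1), s ∉ J ∧ i = blockIdx J s + 1 := by
  obtain ⟨a, ha⟩ := hr.exists_eq (m := i + 1) ⟨by omega, h2⟩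
  rw [blockMap_succ] at ha
  obtain ⟨s, hs, e⟩ := exists_notMem_blockIdx_eq J (i - 1) (w a) (w a).isLt (by omega)
  exact ⟨s, hs, by omega⟩

/-- Each coclass has a representative whose inverse is increasing on the blocks. -/
theorem exists_inv_mem_solomonS {n : ℕ} (J : Set (Fin (n - 1))) (w : Equiv.Perm (Fin n)) :
    ∃ x, blockMap J x = blockMap J w ∧ x⁻¹ ∈ solomonS n J := by
  obtain ⟨x, hx, hmin⟩ := Set.exists_min_image {x | blockMap J x = blockMap J w}
    (fun x => (invSet x⁻¹).card) (Set.toFinite _) ⟨w, rfl⟩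
  refine ⟨x, hx, (mem_solomonS_iff J _).2 fun s hs => ?_⟩
  refine (lt_or_gt_loS_hiS x⁻¹ s).resolve_right fun h => ?_
  have hinv : (simpleS n s)⁻¹ = simpleS n s := Equiv.swap_inv _ _
  have h1 := hmin (simpleS n s * x) (by
    refine Eq.trans (blockMap_eq_iff.2 fun a => ?_) hx
    exact (mem_parabolicS_iff J _).1 (Subgroup.subset_closure (Set.mem_image_of_mem _ hs)) (x a))
  rw [mul_inv_rev, hinv] at h1
  have h2 := card_invSet_mul_simpleS_of_gt x⁻¹ s h
  omega

theorem solomonS_lt {n : ℕ} {J : Set (Fin (n - 1))} {w : Equiv.Perm (Fin n)}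
    (hw : w ∈ solomonS n J) {a b : Fin n} (hab : a < b) (h : blockIdx J a = blockIdx J b) :
    w a < w b :=
  rel_of_blockIdx_eq (R := fun a b => w a < w b) (fun _ _ _ => lt_trans)
    ((mem_solomonS_iff J w).1 hw) hab h

/-- The two blocks merged by `s` lie in one block of `J ∪ {s}`, on both sides of the step `s`. -/
theorem merged_blocks {n : ℕ} {J : Set (Fin (n - 1))} {s : Fin (n - 1)} (hs : s ∉ J)
    {a b : Fin n} (ha : blockIdx J a = blockIdx J s) (hb : blockIdx J b = blockIdx J s + 1) :
    a < b ∧ blockIdx (J ∪ {s}) a = blockIdx (J ∪ {s}) b := by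
  have e := blockIdx_succ_of_notMem hs
  have h1 : (a : ℕ) ≤ s := by
    by_contra h
    have := blockIdx_mono J (Nat.succ_le_of_lt (not_le.1 h))
    simp only [Nat.succ_eq_add_one] at this
    omega
  have h2 : ¬(b : ℕ) ≤ s := fun h => by
    have := blockIdx_mono J h
    omega
  refine ⟨Fin.lt_def.2 (by omega), ?_⟩
  rw [blockIdx_insert hs, blockIdx_insert hs, if_pos h1, if_neg h2]
  omega

/-- A longest element of a parabolic subgroup reverses each block. -/
theorem longest_gt {n : ℕ} {J : Set (Fin (n - 1))} {z : Equiv.Perm (Fin n)}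
    (hz : z ∈ parabolicS n J) (hmax : ∀ x ∈ parabolicS n J, lenS n x ≤ lenS n z)
    {a b : Fin n} (hab : a < b) (h : blockIdx J a = blockIdx J b) : z b < z a := by
  refine rel_of_blockIdx_eq (R := fun a b => z b < z a) (fun _ _ _ h h' => lt_trans h' h)
    (fun s hs => ?_) hab h
  refine (lt_or_gt_loS_hiS z s).resolve_left fun hlt => ?_
  have := (lenS_lt_lenS_mul_simpleS_iff z s).2 hlt
  exact this.not_ge (hmax _ (mul_mem hz (Subgroup.subset_closure (Set.mem_image_of_mem _ hs))))

/-- The inverse of a longest element of a parabolic subgroup reverses each block. -/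
theorem longest_inv_gt {n : ℕ} {J : Set (Fin (n - 1))} {z : Equiv.Perm (Fin n)}
    (hz : z ∈ parabolicS n J) (hmax : ∀ x ∈ parabolicS n J, lenS n x ≤ lenS n z)
    {a b : Fin n} (hab : a < b) (h : blockIdx J a = blockIdx J b) : z⁻¹ b < z⁻¹ a := by
  by_contra hc
  have hlt : z⁻¹ a < z⁻¹ b := lt_of_le_of_ne (not_lt.1 hc) fun h => hab.ne (z⁻¹.injective h)
  have hinv := (mem_parabolicS_iff J _).1 (inv_mem hz)
  have := longest_gt hz hmax hlt (by rw [hinv, hinv, h])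
  simp only [perm_apply_inv_self] at this
  exact lt_asymm this hab

/-! ### Comparison of the two orders -/

theorem bStep_of_solomonS {n : ℕ} (hn : 1 ≤ n) {J : Set (Fin (n - 1))} {s : Fin (n - 1)}
    {w : Equiv.Perm (Fin n)} (hs : s ∉ J) (hw : w⁻¹ ∈ solomonS n (J ∪ {s})) :
    BStep n (blockMap J w) (blockMap (J ∪ {s}) w) := by
  have hr := isPF_blockMap hn J w
  have hle : blockIdx J (s + 1) ≤ blockIdx J (n - 1) := blockIdx_mono J (by omega)
  rw [blockIdx_succ_of_notMem hs] at hle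
  refine ⟨_, blockIdx J s + 1, by omega, by omega, Or.inl ⟨hr, ?_, (tF_comp_blockMap hs hr).symm⟩⟩
  intro v v' hv hv'
  obtain ⟨a, rfl, ha⟩ := exists_of_blockMap_eq_succ hv
  obtain ⟨b, rfl, hb⟩ := exists_of_blockMap_eq_succ hv'
  obtain ⟨hab, he⟩ := merged_blocks hs ha hb
  have := solomonS_lt hw hab he
  simp only [perm_inv_apply_self] at this
  exact Nat.succ_lt_succ this

theorem bStep_of_solomonS_longest {n : ℕ} (hn : 1 ≤ n) {J : Set (Fin (n - 1))}
    {s : Fin (n - 1)} {w z : Equiv.Perm (Fin n)} (hs : s ∉ J)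
    (hw : w⁻¹ ∈ solomonS n (J ∪ {s})) (hz : z ∈ parabolicS n (J ∪ {s}))
    (hmax : ∀ x ∈ parabolicS n (J ∪ {s}), lenS n x ≤ lenS n z) :
    BStep n (blockMap (J ∪ {s}) w) (blockMap J (z⁻¹ * w)) := by
  have hr := isPF_blockMap hn J (z⁻¹ * w)
  have hle : blockIdx J (s + 1) ≤ blockIdx J (n - 1) := blockIdx_mono J (by omega)
  rw [blockIdx_succ_of_notMem hs] at hle
  refine ⟨_, blockIdx J s + 1, by omega, by omega, Or.inr ⟨hr, ?_, ?_⟩⟩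
  · intro v v' hv hv'
    obtain ⟨a, rfl, ha⟩ := exists_of_blockMap_eq_succ hv
    obtain ⟨b, rfl, hb⟩ := exists_of_blockMap_eq_succ hv'
    obtain ⟨hab, he⟩ := merged_blocks hs ha hb
    have h1 := longest_gt hz hmax hab he
    have hp := (mem_parabolicS_iff _ _).1 hz
    have := solomonS_lt hw h1 (by rw [hp, hp, he])
    simp only [Equiv.Perm.mul_apply, perm_apply_inv_self, perm_inv_apply_self] at this
    exact Nat.succ_lt_succ this
  · rw [tF_comp_blockMap hs hr, blockMap_eq_iff]
    exact fun a => ((mem_parabolicS_iff _ _).1 (inv_mem hz) (w a)).symm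

theorem blockMap_longest_eq {n : ℕ} {J : Set (Fin (n - 1))} {z : Equiv.Perm (Fin n)}
    (hz : z ∈ parabolicS n J) (w : Equiv.Perm (Fin n)) : blockMap J (z * w) = blockMap J w :=
  blockMap_eq_iff.2 fun a => (mem_parabolicS_iff J z).1 hz (w a)

theorem exists_of_bStep {n : ℕ} {f g : ℕ → ℕ}
    (ωf : Set (Fin (n - 1)) → Equiv.Perm (Fin n))
    (hω : ∀ J, ωf J ∈ parabolicS n J ∧ ∀ x ∈ parabolicS n J, lenS n x ≤ lenS n (ωf J))
    (h : BStep n f g) :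
    ∃ (J : Set (Fin (n - 1))) (s : Fin (n - 1)) (w : Equiv.Perm (Fin n)),
      s ∉ J ∧ w⁻¹ ∈ solomonS n (J ∪ {s}) ∧
      ((f = blockMap J w ∧ g = blockMap (J ∪ {s}) w) ∨
       (f = blockMap (J ∪ {s}) w ∧ g = blockMap J ((ωf (J ∪ {s}))⁻¹ * w))) := by
  obtain ⟨r, i, h1, h2, ⟨hf, hinc, rfl⟩ | ⟨hg, hdec, rfl⟩⟩ := h
  · obtain ⟨J, w', rfl⟩ := hf.exists_eq_blockMap
    obtain ⟨w, e, hw⟩ := exists_inv_mem_solomonS J w'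
    rw [← e] at hf hinc ⊢
    obtain ⟨s, hs, rfl⟩ := exists_step_of_isPF hf h1 h2
    refine ⟨J, s, w, hs, (mem_solomonS_iff _ _).2 ?_, Or.inl ⟨rfl, tF_comp_blockMap hs hf⟩⟩
    rintro t (ht | rfl)
    · exact (mem_solomonS_iff _ _).1 hw t ht
    · refine Nat.lt_of_succ_lt_succ (hinc _ _ ?_ ?_)
      · rw [Nat.succ_eq_add_one, blockMap_succ, perm_apply_inv_self, loS_val]
      · rw [Nat.succ_eq_add_one, blockMap_succ, perm_apply_inv_self, hiS_val,
          blockIdx_succ_of_notMem hs]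
  · obtain ⟨J, w', rfl⟩ := hg.exists_eq_blockMap
    obtain ⟨w, e, hw⟩ := exists_inv_mem_solomonS J w'
    obtain ⟨hz, hmax⟩ := hω J
    rw [← e, ← blockMap_longest_eq hz] at hg hdec ⊢
    obtain ⟨s, hs, rfl⟩ := exists_step_of_isPF hg h1 h2
    set u := ωf J * w with hu
    obtain ⟨hzK, hmaxK⟩ := hω (J ∪ {s})
    have hstep : ∀ t ∈ J ∪ {s}, u⁻¹ (hiS t) < u⁻¹ (loS t) := by
      rintro t (ht | rfl)
      · have ht' : blockIdx J (loS t) = blockIdx J (hiS t) := (blockIdx_succ_of_mem ht).symm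
        have h3 := longest_inv_gt hz hmax (Fin.lt_def.2 (Nat.lt_succ_self _)) ht'
        have hp := (mem_parabolicS_iff _ _).1 (inv_mem hz)
        have := solomonS_lt hw h3 (by rw [hp, hp, ht'])
        rw [hu, mul_inv_rev]
        exact this
      · refine Nat.lt_of_succ_lt_succ (hdec _ _ ?_ ?_)
        · rw [Nat.succ_eq_add_one, blockMap_succ, perm_apply_inv_self, loS_val]
        · rw [Nat.succ_eq_add_one, blockMap_succ, perm_apply_inv_self, hiS_val,
            blockIdx_succ_of_notMem hs]
    refine ⟨J, s, ωf (J ∪ {s}) * u, hs, (mem_solomonS_iff _ _).2 fun t ht => ?_,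
      Or.inr ⟨?_, by rw [inv_mul_cancel_left]⟩⟩
    · have ht' : blockIdx (J ∪ {s}) (loS t) = blockIdx (J ∪ {s}) (hiS t) :=
        (blockIdx_succ_of_mem ht).symm
      have h3 := longest_inv_gt hzK hmaxK (Fin.lt_def.2 (Nat.lt_succ_self _)) ht'
      have hp := (mem_parabolicS_iff _ _).1 (inv_mem hzK)
      rw [mul_inv_rev]
      exact rel_of_blockIdx_eq (R := fun a b => u⁻¹ b < u⁻¹ a) (fun _ _ _ h h' => lt_trans h' h)
        hstep h3 (by rw [hp, hp, ht'])
    · rw [tF_comp_blockMap hs hg, blockMap_longest_eq hzK]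

theorem pRelS_iff_bStep {n : ℕ} (hn : 1 ≤ n) (ωS : Equiv.Perm (Fin n))
    (ωf ξ : Set (Fin (n - 1)) → Equiv.Perm (Fin n))
    (hω : ∀ J, ωf J ∈ parabolicS n J ∧ ∀ x ∈ parabolicS n J, lenS n x ≤ lenS n (ωf J))
    (hξ : ∀ J, ωS = ξ J * ωf J) (J K : Set (Fin (n - 1))) (w x : Equiv.Perm (Fin n)) :
    pRelS n ξ (coclassS n J w) (coclassS n K x) ↔ BStep n (blockMap J w) (blockMap K x) := by
  have hα : ∀ (L M : Set (Fin (n - 1))) (y : Equiv.Perm (Fin n)),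
      blockMap L (((ξ M)⁻¹ * ξ L)⁻¹ * y) = blockMap L ((ωf M)⁻¹ * y) := by
    intro L M y
    have e : ((ξ M)⁻¹ * ξ L)⁻¹ * y = ωf L * ((ωf M)⁻¹ * y) := by
      rw [eq_mul_inv_of_mul_eq (hξ M).symm, eq_mul_inv_of_mul_eq (hξ L).symm]
      group
    rw [e, blockMap_longest_eq (hω L).1]
  constructor
  · rintro ⟨L, s, y, hs, hy, ⟨h1, h2⟩ | ⟨h1, h2⟩⟩
    · rw [coclassS_eq_iff.1 h1, coclassS_eq_iff.1 h2]
      exact bStep_of_solomonS hn hs hy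
    · rw [coclassS_eq_iff.1 h1, coclassS_eq_iff.1 h2, hα]
      exact bStep_of_solomonS_longest hn hs hy (hω _).1 (hω _).2
  · intro h
    obtain ⟨L, s, y, hs, hy, h⟩ := exists_of_bStep ωf hω h
    refine ⟨L, s, y, hs, hy, h.imp (fun ⟨h1, h2⟩ => ?_) fun ⟨h1, h2⟩ => ?_⟩
    · exact ⟨coclassS_eq_iff.2 h1, coclassS_eq_iff.2 h2⟩
    · exact ⟨coclassS_eq_iff.2 h1, coclassS_eq_iff.2 (h2.trans (hα _ _ _).symm)⟩

theorem reflTransGen_pRelS_iff_bLE {n : ℕ} (hn : 1 ≤ n) (ωS : Equiv.Perm (Fin n))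
    (ωf ξ : Set (Fin (n - 1)) → Equiv.Perm (Fin n))
    (hω : ∀ J, ωf J ∈ parabolicS n J ∧ ∀ x ∈ parabolicS n J, lenS n x ≤ lenS n (ωf J))
    (hξ : ∀ J, ωS = ξ J * ωf J) (J K : Set (Fin (n - 1))) (w x : Equiv.Perm (Fin n)) :
    Relation.ReflTransGen (pRelS n ξ) (coclassS n J w) (coclassS n K x) ↔
      BLE n (blockMap J w) (blockMap K x) := by
  have hiff := pRelS_iff_bStep hn ωS ωf ξ hω hξ
  constructor
  · intro h
    have key : ∀ C, Relation.ReflTransGen (pRelS n ξ) (coclassS n J w) C →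
        ∃ L y, C = coclassS n L y ∧ BLE n (blockMap J w) (blockMap L y) := by
      intro C hC
      induction hC with
      | refl => exact ⟨J, w, rfl, .refl⟩
      | @tail B C _ hBC ih =>
        obtain ⟨L, y, rfl, hL⟩ := ih
        have hC : ∃ M z, C = coclassS n M z := by
          obtain ⟨M, s, z, _, _, ⟨_, h⟩ | ⟨_, h⟩⟩ := hBC <;> exact ⟨_, _, h⟩
        obtain ⟨M, z, rfl⟩ := hC
        exact ⟨M, z, rfl, hL.tail ((hiff _ _ _ _).1 hBC)⟩
    obtain ⟨L, y, e, hL⟩ := key _ h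
    rwa [coclassS_eq_iff.1 e]
  · intro h
    have key : ∀ g, BLE n (blockMap J w) g → ∃ L y, g = blockMap L y ∧
        Relation.ReflTransGen (pRelS n ξ) (coclassS n J w) (coclassS n L y) := by
      intro g hg
      induction hg with
      | refl => exact ⟨J, w, rfl, .refl⟩
      | @tail f g _ hfg ih =>
        obtain ⟨L, y, rfl, hL⟩ := ih
        have hg : ∃ (M : Set (Fin (n - 1))) (z : Equiv.Perm (Fin n)),
            g = blockMap M z := by
          obtain ⟨M, s, z, _, _, ⟨_, h⟩ | ⟨_, h⟩⟩ := exists_of_bStep ωf hω hfg <;>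
            exact ⟨_, _, h⟩
        obtain ⟨M, z, rfl⟩ := hg
        exact ⟨M, z, rfl, hL.tail ((hiff _ _ _ _).2 hfg)⟩
    obtain ⟨L, y, e, hL⟩ := key _ h
    rwa [coclassS_eq_iff.2 e]

/-! ### Compositions -/

theorem composition_index_mono {n : ℕ} (c : Composition n) : Monotone c.index := by
  intro a b hab
  by_contra h
  have h1 := c.lt_sizeUpTo_index_succ b
  have h2 := c.sizeUpTo_index_le a
  have h3 : c.sizeUpTo (c.index b).succ ≤ c.sizeUpTo (c.index a) :=
    c.monotone_sizeUpTo (Nat.succ_le_of_lt (not_le.1 h))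
  have h4 : (a : ℕ) ≤ b := hab
  omega

theorem composition_index_surjective {n : ℕ} (c : Composition n) :
    Function.Surjective c.index :=
  fun i => ⟨c.embedding i ⟨0, c.one_le_blocksFun i⟩, c.index_embedding _ _⟩

theorem exists_index_eq_blockIdx {n : ℕ} (c : Composition n) :
    ∃ J : Set (Fin (n - 1)), ∀ k : Fin n, (c.index k : ℕ) = blockIdx J k := by
  refine ⟨_, eq_blockIdx_of_monotone (g := fun k => (c.index k : ℕ))
    (fun a b h => composition_index_mono c h) fun k m hm => ?_⟩
  obtain ⟨j, hj⟩ := composition_index_surjective c ⟨m, hm.trans_lt (c.index k).isLt⟩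
  exact ⟨j, congrArg Fin.val hj⟩

theorem mem_youngCoclass_iff {n : ℕ} (c : Composition n) (σ x : Equiv.Perm (Fin n)) :
    x ∈ youngCoclass c σ ↔ ∀ a, c.index (x a) = c.index (σ a) := by
  constructor
  · rintro ⟨p, hp, rfl⟩ a
    exact hp (σ a)
  · intro h
    exact ⟨x * σ⁻¹, fun a => by simpa using h (σ⁻¹ a), by simp⟩

theorem youngCoclass_eq_coclassS {n : ℕ} {c : Composition n} {J : Set (Fin (n - 1))}
    (h : ∀ k : Fin n, (c.index k : ℕ) = blockIdx J k) (σ : Equiv.Perm (Fin n)) :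
    youngCoclass c σ = coclassS n J σ := by
  ext x
  simp only [mem_youngCoclass_iff, mem_coclassS_iff, ← h, Fin.ext_iff]

theorem psiF_succ {n : ℕ} (c : Composition n) (σ : Equiv.Perm (Fin n)) (a : Fin n) :
    psiF c σ (a + 1) = c.index (σ a) + 1 := by
  have := a.isLt
  rw [psiF, dif_pos ⟨by omega, by omega⟩]
  rfl

theorem psiF_of_not {n v : ℕ} (c : Composition n) (σ : Equiv.Perm (Fin n))
    (h : ¬(1 ≤ v ∧ v ≤ n)) : psiF c σ v = 0 :=
  dif_neg h

theorem psiF_eq_blockMap {n : ℕ} {c : Composition n} {J : Set (Fin (n - 1))}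
    (h : ∀ k : Fin n, (c.index k : ℕ) = blockIdx J k) (σ : Equiv.Perm (Fin n)) :
    psiF c σ = blockMap J σ := by
  rw [eq_blockMap_iff fun v => psiF_of_not c σ]
  intro a
  rw [psiF_succ, h]

theorem psiF_eq_comp_iff {n : ℕ} {c c' : Composition n} {σ σ' : Equiv.Perm (Fin n)}
    {ρ : ℕ → ℕ} (h0 : ρ 0 = 0) : psiF c' σ' = ρ ∘ psiF c σ ↔
      ∀ a, (c'.index (σ' a) : ℕ) + 1 = ρ (c.index (σ a) + 1) := by
  constructor
  · intro h a
    rw [← psiF_succ, ← psiF_succ, h]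
    rfl
  · intro h
    funext v
    by_cases hv : 1 ≤ v ∧ v ≤ n
    · obtain ⟨a, rfl⟩ := exists_eq_succ hv
      rw [Function.comp_apply, psiF_succ, psiF_succ, h]
    · rw [Function.comp_apply, psiF_of_not c' σ' hv, psiF_of_not c σ hv, h0]

/-- A map between block indices, in normalized form. -/
def extendIdx {r s : ℕ} (φ : Fin r → Fin s) : ℕ → ℕ :=
  fun v => if h : 1 ≤ v ∧ v ≤ r then (φ ⟨v - 1, by omega⟩ : ℕ) + 1 else 0

theorem extendIdx_succ {r s : ℕ} (φ : Fin r → Fin s) (i : Fin r) :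
    extendIdx φ (i + 1) = φ i + 1 := by
  have := i.isLt
  rw [extendIdx, dif_pos ⟨by omega, by omega⟩]
  rfl

theorem isPF_extendIdx {r s : ℕ} {φ : Fin r → Fin s} (hφ : Function.Surjective φ) :
    IsPF r s (extendIdx φ) := by
  constructor
  · intro v
    by_cases hv : 1 ≤ v ∧ v ≤ r <;> simp [extendIdx, hv]
  · ext m
    constructor
    · rintro ⟨v, hv, rfl⟩
      obtain ⟨i, rfl⟩ := exists_eq_succ hv
      rw [extendIdx_succ]
      exact ⟨by omega, (φ i).isLt⟩
    · intro hm
      obtain ⟨j, rfl⟩ := exists_eq_succ hm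
      obtain ⟨i, rfl⟩ := hφ j
      exact ⟨i + 1, ⟨by omega, i.isLt⟩, extendIdx_succ φ i⟩

theorem extendIdx_mono {r s : ℕ} {φ : Fin r → Fin s} (hφ : Monotone φ) {a b : ℕ} (ha : 1 ≤ a)
    (hab : a ≤ b) (hb : b ≤ r) : extendIdx φ a ≤ extendIdx φ b := by
  obtain ⟨i, rfl⟩ := exists_eq_succ ⟨ha, hab.trans hb⟩
  obtain ⟨j, rfl⟩ := exists_eq_succ ⟨ha.trans hab, hb⟩
  rw [extendIdx_succ, extendIdx_succ]
  exact Nat.succ_le_succ (hφ (Nat.le_of_succ_le_succ hab))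

theorem youngCoclass_subset_iff {n : ℕ} (c c' : Composition n) (σ σ' : Equiv.Perm (Fin n)) :
    youngCoclass c σ ⊆ youngCoclass c' σ' ↔
      ∃ ρ : ℕ → ℕ, IsPF c.length c'.length ρ ∧
        (∀ a b : ℕ, 1 ≤ a → a ≤ b → b ≤ c.length → ρ a ≤ ρ b) ∧
        psiF c' σ' = ρ ∘ psiF c σ := by
  constructor
  · intro h
    have hσ := (mem_youngCoclass_iff c' σ' σ).1 (h ((mem_youngCoclass_iff c σ σ).2 fun _ => rfl))
    have hidx : ∀ a b, c.index a = c.index b → c'.index a = c'.index b := by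
      intro a b hab
      have hx : Equiv.swap a b * σ ∈ youngCoclass c σ := ⟨_, fun i => by
        rw [Equiv.swap_apply_def]
        split_ifs with h1 h2
        · rw [h1, hab]
        · rw [h2, hab]
        · rfl, rfl⟩
      have := (mem_youngCoclass_iff c' σ' _).1 (h hx) (σ⁻¹ a)
      rw [← hσ, Equiv.Perm.mul_apply, perm_apply_inv_self, Equiv.swap_apply_left] at this
      exact this.symm
    choose e he using composition_index_surjective c
    have hφ : ∀ a, c'.index (e (c.index a)) = c'.index a := fun a => hidx _ _ (he _)
    refine ⟨extendIdx fun i => c'.index (e i), isPF_extendIdx fun j => ?_,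
      fun a b => extendIdx_mono fun i j hij => ?_, (psiF_eq_comp_iff (by simp [extendIdx])).2
        fun a => ?_⟩
    · obtain ⟨a, rfl⟩ := composition_index_surjective c' j
      exact ⟨c.index a, hφ a⟩
    · rcases hij.eq_or_lt with rfl | hlt
      · exact le_rfl
      · refine composition_index_mono c' (le_of_not_ge fun hle => hlt.not_ge ?_)
        rw [← he i, ← he j]
        exact composition_index_mono c hle
    · rw [extendIdx_succ, hφ, hσ]
  · rintro ⟨ρ, hρ, hmono, h⟩ x hx
    rw [psiF_eq_comp_iff (hρ.eq_zero (by omega))] at h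
    have key := eq_of_comp_perm_eq (f := fun k => (c'.index k : ℕ) + 1)
      (g := fun k => ρ (c.index k + 1))
      (fun a b hab => Nat.succ_le_succ (composition_index_mono c' hab))
      (fun a b hab => hmono _ _ (by omega) (Nat.succ_le_succ (composition_index_mono c hab))
        (c.index b).isLt) h
    rw [mem_youngCoclass_iff] at hx ⊢
    intro a
    have e := congrFun key (x a)
    simp only [hx a, ← h a] at e
    exact Fin.ext (Nat.succ_injective e)

/-- under the identification `Ψ` of right coclasses of Young subgroups of `S_n`
with elements of `P_n`:
(1) the coclass `Ψ⁻¹(γ)` is contained in `Ψ⁻¹(δ)` iff `δ = ρ ∘ γ` for a non-decreasing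
surjection `ρ ∈ P_{r,s}`;
(2) the weak Bruhat order on right coclasses corresponds, under `Ψ`, to the
reflexive-transitive closure of the relations `γ <_B t_i ∘ γ` (when `γ⁻¹(i) < γ⁻¹(i+1)`)
and `t_i ∘ γ <_B γ` (when `γ⁻¹(i) > γ⁻¹(i+1)`). -/
theorem coclass_orders_correspond (n : ℕ) (hn : 1 ≤ n)
    (ωS : Equiv.Perm (Fin n)) (ωf ξ : Set (Fin (n - 1)) → Equiv.Perm (Fin n))
    (hS : ∀ w : Equiv.Perm (Fin n), lenS n w ≤ lenS n ωS)
    (hω : ∀ J : Set (Fin (n - 1)), ωf J ∈ parabolicS n J ∧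
      ∀ x ∈ parabolicS n J, lenS n x ≤ lenS n (ωf J))
    (hξ : ∀ J : Set (Fin (n - 1)), ξ J ∈ solomonS n J ∧ ωS = ξ J * ωf J) :
    (∀ (c c' : Composition n) (σ σ' : Equiv.Perm (Fin n)),
      youngCoclass c σ ⊆ youngCoclass c' σ' ↔
        ∃ ρ : ℕ → ℕ, IsPF c.length c'.length ρ ∧
          (∀ a b : ℕ, 1 ≤ a → a ≤ b → b ≤ c.length → ρ a ≤ ρ b) ∧
          psiF c' σ' = ρ ∘ psiF c σ) ∧
    (∀ (c c' : Composition n) (σ σ' : Equiv.Perm (Fin n)),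
      Relation.ReflTransGen (pRelS n ξ) (youngCoclass c σ) (youngCoclass c' σ') ↔
        BLE n (psiF c σ) (psiF c' σ')) := by
  refine ⟨youngCoclass_subset_iff, fun c c' σ σ' => ?_⟩
  obtain ⟨J, hJ⟩ := exists_index_eq_blockIdx c
  obtain ⟨K, hK⟩ := exists_index_eq_blockIdx c'
  rw [youngCoclass_eq_coclassS hJ, youngCoclass_eq_coclassS hK, psiF_eq_blockMap hJ,
    psiF_eq_blockMap hK]
  exact reflTransGen_pRelS_iff_bLE hn ωS ωf ξ hω (fun J => (hξ J).2) J K σ σ'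

end PaperP
end
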